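/- arXiv:1907.07904 — 2 statements merged into one kernel-verified Lean document; each statement's English description precedes it below -/
import Mathlib

section
/- Let g : [0,1] → ℝ be continuous and strictly decreasing with g(1) = 0, and let h : ℝ → [0,1] satisfy h(g(x)) = x for all x ∈ [0,1] and g(h(y)) = y for all y ∈ [0, g(0)]. Define T(x,y) = h(min(g(0), g(x) + g(y))). Then T is a t-norm on [0,1]: for all x, y, z ∈ [0,1] one has T(x,y) ∈ [0,1], T(x,y) = T(y,x), T(T(x,y),z) = T(x,T(y,z)), T is non-decreasing in each argument, and T(x,1) = x. -/
/-- A continuous strictly decreasing additive generator `g` on `[0,1]` with `g 1 = 0` and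
pseudo-inverse `h` generates a t-norm `T (x,y) = h (min (g 0) (g x + g y))`:
it maps `[0,1]²` into `[0,1]`, is commutative, associative, non-decreasing in each
argument, and has `1` as neutral element. -/
theorem generated_tnorm_is_tnorm
    (g h : ℝ → ℝ)
    (hg_cont : ContinuousOn g (Set.Icc 0 1))
    (hg_anti : StrictAntiOn g (Set.Icc 0 1))
    (hg1 : g 1 = 0)
    (hh_mem : ∀ y : ℝ, h y ∈ Set.Icc (0:ℝ) 1)
    (hhg : ∀ x ∈ Set.Icc (0:ℝ) 1, h (g x) = x)
    (hgh : ∀ y ∈ Set.Icc 0 (g 0), g (h y) = y)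
    (T : ℝ → ℝ → ℝ)
    (hT : ∀ x y : ℝ, T x y = h (min (g 0) (g x + g y))) :
    ∀ x ∈ Set.Icc (0:ℝ) 1, ∀ y ∈ Set.Icc (0:ℝ) 1, ∀ z ∈ Set.Icc (0:ℝ) 1,
      T x y ∈ Set.Icc (0:ℝ) 1 ∧
      T x y = T y x ∧
      T (T x y) z = T x (T y z) ∧
      (∀ x' ∈ Set.Icc (0:ℝ) 1, x ≤ x' → T x y ≤ T x' y) ∧
      (∀ y' ∈ Set.Icc (0:ℝ) 1, y ≤ y' → T x y ≤ T x y') ∧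
      T x 1 = x := by
  have h0 : (0:ℝ) ∈ Set.Icc (0:ℝ) 1 := by simp
  have h1 : (1:ℝ) ∈ Set.Icc (0:ℝ) 1 := by simp
  have gpos : ∀ x ∈ Set.Icc (0:ℝ) 1, 0 ≤ g x := fun x hx =>
    hg1 ▸ hg_anti.antitoneOn hx h1 hx.2
  have gle : ∀ x ∈ Set.Icc (0:ℝ) 1, g x ≤ g 0 := fun x hx =>
    hg_anti.antitoneOn h0 hx hx.1
  have gT : ∀ x ∈ Set.Icc (0:ℝ) 1, ∀ y ∈ Set.Icc (0:ℝ) 1,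
      g (T x y) = min (g 0) (g x + g y) := fun x hx y hy => by
    rw [hT]
    exact hgh _ ⟨le_min (gpos 0 h0) (add_nonneg (gpos x hx) (gpos y hy)), min_le_left _ _⟩
  have Tmem : ∀ x y, T x y ∈ Set.Icc (0:ℝ) 1 := fun x y => by
    rw [hT]; exact hh_mem _
  have key : ∀ a ∈ Set.Icc (0:ℝ) 1, ∀ b ∈ Set.Icc (0:ℝ) 1, g b ≤ g a → a ≤ b :=
    fun a ha b hb hab => (hg_anti.le_iff_ge hb ha).1 hab
  intro x hx y hy z hz
  refine ⟨Tmem x y, ?_, ?_, ?_, ?_, ?_⟩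
  · rw [hT, hT, add_comm]
  · rw [hT (T x y) z, hT x (T y z), gT x hx y hy, gT y hy z hz]
    congr 1
    have := gpos x hx
    have := gpos z hz
    grind
  · intro x' hx' hxx
    apply key _ (Tmem _ _) _ (Tmem _ _)
    rw [gT x hx y hy, gT x' hx' y hy]
    have := hg_anti.antitoneOn hx hx' hxx
    gcongr
  · intro y' hy' hyy
    apply key _ (Tmem _ _) _ (Tmem _ _)
    rw [gT x hx y hy, gT x hx y' hy']
    have := hg_anti.antitoneOn hy hy' hyy
    gcongr
  · rw [hT, hg1, add_zero, min_eq_right (gle x hx), hhg x hx]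
end

section
/- Let g : [0,1] → ℝ be continuous and strictly decreasing with g(1) = 0, with pseudo-inverse h satisfying h(g(x)) = x for all x ∈ [0,1] and g(h(y)) = y for all y ∈ [0, g(0)], and let T(x,y) = h(min(g(0), g(x) + g(y))). Then the residuum of T is given by the generator formula: for all x, y, z ∈ [0,1], T(x,z) ≤ y if and only if z ≤ h(max(0, g(y) − g(x))). -/
/-- For a t-norm `T (x,y) = h (min (g 0) (g x + g y))` generated by a continuous strictly
decreasing additive generator `g` with `g 1 = 0` and pseudo-inverse `h`, the residuum is
given by the generator formula: for all `x, y, z ∈ [0,1]`,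
`T (x,z) ≤ y ↔ z ≤ h (max 0 (g y - g x))`. -/
theorem generated_tnorm_residuum
    (g h : ℝ → ℝ)
    (hg_cont : ContinuousOn g (Set.Icc 0 1))
    (hg_anti : StrictAntiOn g (Set.Icc 0 1))
    (hg1 : g 1 = 0)
    (hh_mem : ∀ y : ℝ, h y ∈ Set.Icc (0:ℝ) 1)
    (hhg : ∀ x ∈ Set.Icc (0:ℝ) 1, h (g x) = x)
    (hgh : ∀ y ∈ Set.Icc 0 (g 0), g (h y) = y)
    (T : ℝ → ℝ → ℝ)
    (hT : ∀ x y : ℝ, T x y = h (min (g 0) (g x + g y))) :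
    ∀ x ∈ Set.Icc (0:ℝ) 1, ∀ y ∈ Set.Icc (0:ℝ) 1, ∀ z ∈ Set.Icc (0:ℝ) 1,
      (T x z ≤ y ↔ z ≤ h (max 0 (g y - g x))) := by
  have m0 : (0:ℝ) ∈ Set.Icc (0:ℝ) 1 := by simp
  have m1 : (1:ℝ) ∈ Set.Icc (0:ℝ) 1 := by simp
  have hn : ∀ t ∈ Set.Icc (0:ℝ) 1, 0 ≤ g t ∧ g t ≤ g 0 := fun t ht =>
    ⟨hg1 ▸ (hg_anti.le_iff_ge m1 ht).2 ht.2, (hg_anti.le_iff_ge ht m0).2 ht.1⟩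
  intro x hx y hy z hz
  obtain ⟨x0, x1⟩ := hn x hx
  obtain ⟨y0, y1⟩ := hn y hy
  obtain ⟨z0, z1⟩ := hn z hz
  rw [hT, ← hg_anti.le_iff_ge hy (hh_mem _), ← hg_anti.le_iff_ge (hh_mem _) hz,
    hgh _ ⟨le_min (by linarith) (by linarith), min_le_left _ _⟩,
    hgh _ ⟨le_max_left _ _, max_le (by linarith) (by linarith)⟩, le_min_iff, max_le_iff]
  constructor
  · rintro ⟨_, h2⟩
    exact ⟨z0, by linarith⟩
  · rintro ⟨_, h2⟩
    exact ⟨y1, by linarith⟩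
end
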